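/- Assume V is real-valued, θ₀', θ_R' ∈ (0,π), and let z ∈ ℝ with z < inf σ(H_{θ₀',θ_R'}) be such that the solutions ǔ_±(z,·) described below exist (which holds, e.g., for z sufficiently negative). Let ǔ_+(z,·), ǔ_−(z,·) solve −u''+Vu = zu with u,u' ∈ AC([0,R]), normalized by ǔ_+(z,0) = 1, cos(θ_R')ǔ_+(z,R) − sin(θ_R')ǔ_+'(z,R) = 0, and ǔ_−(z,R) = 1, cos(θ₀')ǔ_−(z,0) + sin(θ₀')ǔ_−'(z,0) = 0. Then, writing H' = H_{θ₀',θ_R'}: ((H' − zI)^{1/2}ǔ_+(z,·), (H' − zI)^{1/2}ǔ_+(z,·))_{L²} = −[ǔ_+'(z,0) + cot(θ₀')]; ((H' − zI)^{1/2}ǔ_+(z,·), (H' − zI)^{1/2}ǔ_−(z,·))_{L²} = −ǔ_−(z,0)[ǔ_+'(z,0) + cot(θ₀')] = ǔ_+(z,R)[ǔ_−'(z,R) − cot(θ_R')] = ((H' − zI)^{1/2}ǔ_−(z,·), (H' − zI)^{1/2}ǔ_+(z,·))_{L²}; and ((H' − zI)^{1/2}ǔ_−(z,·), (H' − zI)^{1/2}ǔ_−(z,·))_{L²}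 = ǔ_−'(z,R) − cot(θ_R'). -/

import Mathlib

open MeasureTheory Filter
open scoped InnerProductSpace

noncomputable section
open scoped Classical


variable {H : Type*} [NormedAddCommGroup H] [InnerProductSpace ℂ H] [CompleteSpace H]

/-- `T` is the (bounded, everywhere defined) inverse of `A - z·I`. -/
def IsResolvent (A : H →ₗ.[ℂ] H) (z : ℂ) (T : H →L[ℂ] H) : Prop :=
  (∀ x : H, ∃ hx : T x ∈ A.domain, A ⟨T x, hx⟩ - z • T x = x) ∧
  ∀ u : A.domain, T (A u - z • (u : H)) = (u : H)

/-- The resolvent set of an unbounded operator. -/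
def resolventSetP (A : H →ₗ.[ℂ] H) : Set ℂ := {z | ∃ T, IsResolvent A z T}

/-- The spectrum of an unbounded operator. -/
def specP (A : H →ₗ.[ℂ] H) : Set ℂ := (resolventSetP A)ᶜ

/-- The resolvent `(A - z·I)⁻¹` (junk value `0` off the resolvent set). -/
def res (A : H →ₗ.[ℂ] H) (z : ℂ) : H →L[ℂ] H :=
  if h : ∃ T, IsResolvent A z T then h.choose else 0

/-- The operator `A + t·I` (same domain). -/
def shiftP (A : H →ₗ.[ℂ] H) (t : ℂ) : H →ₗ.[ℂ] H :=
  ⟨A.domain, A.toFun + t • A.domain.subtype⟩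

/-- `A` is of positive type: `(-∞,0] ⊆ ρ(A)` and `sup_{t ≥ 0} ‖(1+t)(A+t)⁻¹‖ < ∞`. -/
def IsPositiveTypeP (A : H →ₗ.[ℂ] H) : Prop :=
  (∀ x : ℝ, x ≤ 0 → (x : ℂ) ∈ resolventSetP A) ∧
  ∃ M : ℝ, ∀ t : ℝ, 0 ≤ t → (1 + t) * ‖res A (-(t : ℂ))‖ ≤ M

/-- The open sector of half-opening angle `ω` about the positive reals
(`(0,∞)` for `ω = 0`). -/
def sectorS (ω : ℝ) : Set ℂ :=
  if ω = 0 then (fun x : ℝ => (x : ℂ)) '' Set.Ioi 0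
  else {z : ℂ | z ≠ 0 ∧ |Complex.arg z| < ω}

/-- `A` is sectorial of angle `ω`. -/
def IsSectorialP (A : H →ₗ.[ℂ] H) (ω : ℝ) : Prop :=
  specP A ⊆ closure (sectorS ω) ∧
  ∀ ω' : ℝ, ω < ω' → ω' < Real.pi →
    ∃ M : ℝ, ∀ z ∈ (closure (sectorS ω'))ᶜ, ‖z‖ * ‖res A z‖ ≤ M

/-- The shifted sector `-t₀ + S_ω`. -/
def shiftedSector (t0 ω : ℝ) : Set ℂ := (fun w => -(t0 : ℂ) + w) '' sectorS ω

/-- The region `ℂ \ closure (-t₀ + S_ω)`. -/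
def offSector (t0 ω : ℝ) : Set ℂ := (closure (shiftedSector t0 ω))ᶜ

/-- The bounded operator `(A - z·I)^{-1/2}`, defined by the Balakrishnan-type formula
`(1/π) ∫₀^∞ t^{-1/2} (A + (t - z)·I)⁻¹ dt`. -/
def negSqrt (A : H →ₗ.[ℂ] H) (z : ℂ) : H →L[ℂ] H :=
  ((Real.pi : ℂ))⁻¹ • ∫ t in Set.Ioi (0 : ℝ), ((Real.sqrt t : ℂ))⁻¹ • res A (z - t)

/-- Trace-class (nuclear) bounded operators, characterized by
`sup { ∑ |⟨eᵢ, T fᵢ⟩| : (eᵢ), (fᵢ) finite orthonormal families } < ∞`. -/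
def IsTraceClass (T : H →L[ℂ] H) : Prop :=
  ∃ C : ℝ, ∀ (n : ℕ) (e f : Fin n → H), Orthonormal ℂ e → Orthonormal ℂ f →
    ∑ i, ‖⟪e i, T (f i)⟫_ℂ‖ ≤ C

/-- The trace norm `‖T‖₁`. -/
def traceNorm (T : H →L[ℂ] H) : ℝ :=
  sSup {s : ℝ | ∃ (n : ℕ) (e f : Fin n → H), Orthonormal ℂ e ∧ Orthonormal ℂ f ∧
    s = ∑ i, ‖⟪e i, T (f i)⟫_ℂ‖}

/-- The trace of a (trace-class) operator, computed in the Hilbert basis `b`. -/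
def traceH (b : HilbertBasis ℕ ℂ H) (T : H →L[ℂ] H) : ℂ :=
  ∑' n, ⟪(b n : H), T (b n)⟫_ℂ

/-- The Fredholm determinant `det (I + T)` (for `T` trace class), computed as the limit of
finite-section determinants along the Hilbert basis `b`. -/
def detI (b : HilbertBasis ℕ ℂ H) (T : H →L[ℂ] H) : ℂ :=
  limUnder atTop fun F : Finset ℕ =>
    Matrix.det (Matrix.of fun i j : F =>
      (if (i : ℕ) = (j : ℕ) then (1 : ℂ) else 0) + ⟪(b (i : ℕ) : H), T (b (j : ℕ))⟫_ℂ)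


/-! ### One-dimensional Schrödinger operators on `[0,R]` -/

/-- The underlying Hilbert space `L²((0,R); dx)`. -/
abbrev SchSp (Rr : ℝ) :=
  MeasureTheory.Lp ℂ 2 (MeasureTheory.volume.restrict (Set.Ioo (0 : ℝ) Rr))

/-- `u` (with derivative `du`) solves `-u'' + V u = z u` on `[0,R]`, with
`u, u' ∈ AC([0,R])` (the second derivative being encoded in integrated form). -/
def SolODE (Rr : ℝ) (V : ℝ → ℂ) (z : ℂ) (u du : ℝ → ℂ) : Prop :=
  (∀ x ∈ Set.Icc (0 : ℝ) Rr, HasDerivWithinAt u (du x) (Set.Icc (0 : ℝ) Rr) x) ∧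
  ∀ x ∈ Set.Icc (0 : ℝ) Rr, du x = du 0 + ∫ t in (0 : ℝ)..x, (V t - z) * u t

/-- The boundary trace `γ_{θ₀,θ_R}(u) = (cos θ₀ u(0) + sin θ₀ u'(0),
cos θ_R u(R) - sin θ_R u'(R))`. -/
def bdryC (Rr : ℝ) (t0 tR : ℂ) (u du : ℝ → ℂ) : Fin 2 → ℂ :=
  ![Complex.cos t0 * u 0 + Complex.sin t0 * du 0,
    Complex.cos tR * u Rr - Complex.sin tR * du Rr]

/-- `g` (with derivative `dg`) is an absolutely continuous representative of `f ∈ L²`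
satisfying `-g'' + V g - z g = h` (in integrated form, with `h₀` a representative of
`h ∈ L²`); i.e. `f` represents `(H - z)⁻¹ h`. -/
def SolvesAt (Rr : ℝ) (V : ℝ → ℂ) (z : ℂ) (f h : SchSp Rr) (g dg : ℝ → ℂ) : Prop :=
  (∀ᵐ x ∂(MeasureTheory.volume.restrict (Set.Ioo (0 : ℝ) Rr)), f x = g x) ∧
  (∀ x ∈ Set.Icc (0 : ℝ) Rr, HasDerivWithinAt g (dg x) (Set.Icc (0 : ℝ) Rr) x) ∧
  ∃ h0 : ℝ → ℂ,
    (∀ᵐ x ∂(MeasureTheory.volume.restrict (Set.Ioo (0 : ℝ) Rr)), h x = h0 x) ∧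
    ∀ x ∈ Set.Icc (0 : ℝ) Rr,
      dg x = dg 0 + ∫ t in (0 : ℝ)..x, (V t * g t - z * g t - h0 t)

/-- `Hop` is the Schrödinger operator `H_{θ₀,θ_R} = -d²/dx² + V` in `L²((0,R); dx)` with
separated boundary conditions `γ_{θ₀,θ_R}(g) = 0`, characterized through its graph. -/
def IsSchrodingerOp (Rr : ℝ) (V : ℝ → ℂ) (t0 tR : ℂ)
    (Hop : SchSp Rr →ₗ.[ℂ] SchSp Rr) : Prop :=
  ∀ f h : SchSp Rr, (f, h) ∈ Hop.graph ↔
    ∃ g dg : ℝ → ℂ, SolvesAt Rr V 0 f h g dg ∧ bdryC Rr t0 tR g dg = 0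

/-- `Λ` is the boundary data map `Λ_{θ₀,θ_R}^{θ₀',θ_R'}(z)`: for every solution `u` of
`-u'' + Vu = zu`, `Λ` maps `γ_{θ₀,θ_R}(u)` to `γ_{θ₀',θ_R'}(u)`. -/
def IsBoundaryDataMap (Rr : ℝ) (V : ℝ → ℂ) (t0 tR t0' tR' : ℂ) (z : ℂ)
    (Λ : Matrix (Fin 2) (Fin 2) ℂ) : Prop :=
  ∀ u du : ℝ → ℂ, SolODE Rr V z u du →
    Λ.mulVec (bdryC Rr t0 tR u du) = bdryC Rr t0' tR' u du

/-- `G` is the map `γ_{θ₀',θ_R'} ∘ (Hop - z)⁻¹ : L²((0,R)) → ℂ²`. -/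
def IsBdryResolventMap (Rr : ℝ) (V : ℝ → ℂ) (t0' tR' : ℂ) (z : ℂ)
    (Hop : SchSp Rr →ₗ.[ℂ] SchSp Rr)
    (G : SchSp Rr →L[ℂ] EuclideanSpace ℂ (Fin 2)) : Prop :=
  ∀ (h : SchSp Rr) (g dg : ℝ → ℂ), SolvesAt Rr V z (res Hop z h) h g dg →
    ∀ i : Fin 2, G h i = bdryC Rr t0' tR' g dg i

/-- The region `ℂ \ [c, ∞)`. -/
def offCut (c : ℝ) : Set ℂ := {z : ℂ | z.im ≠ 0 ∨ z.re < c}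

/-- `N` is the family `z ↦ (Hop - z)^{-1/2}`, defined via the spectral theorem with branch
cut along `[c, ∞)` (`c = inf σ(Hop)`): analytic on `ℂ \ [c,∞)`, squaring to the resolvent,
and positive (self-adjoint) for real `z < c`. -/
def IsSqrtResFam (Rr : ℝ) (Hop : SchSp Rr →ₗ.[ℂ] SchSp Rr) (c : ℝ)
    (N : ℂ → (SchSp Rr →L[ℂ] SchSp Rr)) : Prop :=
  (∀ z ∈ offCut c, (N z).comp (N z) = res Hop z) ∧
  (∀ x : ℝ, x < c →
    (∀ v w : SchSp Rr, ⟪N (x : ℂ) v, w⟫_ℂ = ⟪v, N (x : ℂ) w⟫_ℂ) ∧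
    ∀ v : SchSp Rr, 0 ≤ (⟪v, N (x : ℂ) v⟫_ℂ).re) ∧
  DifferentiableOn ℂ N (offCut c)

/-- The infimum `e₀ = inf(σ(Hop) ∪ σ(Hop'))`. -/
def einf (Rr : ℝ) (Hop Hop' : SchSp Rr →ₗ.[ℂ] SchSp Rr) : ℝ :=
  sInf {x : ℝ | (x : ℂ) ∈ specP Hop ∪ specP Hop'}

/-- The infimum of the spectrum of a single operator. -/
def einf1 (Rr : ℝ) (Hop : SchSp Rr →ₗ.[ℂ] SchSp Rr) : ℝ :=
  sInf {x : ℝ | (x : ℂ) ∈ specP Hop}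



/-- `P` is an absolutely continuous function on `[a,b]` with almost everywhere derivative `p`. -/
def IsPrimitiveOn (a b : ℝ) (P p : ℝ → ℂ) : Prop :=
  IntervalIntegrable p volume a b ∧ ∀ x ∈ Set.Icc a b, P x = P a + ∫ t in a..x, p t

theorem IntervalIntegrable.absolutelyContinuousOnInterval_integral_complex {p : ℝ → ℂ} {a b : ℝ}
    (hp : IntervalIntegrable p volume a b) :
    AbsolutelyContinuousOnInterval (fun x => ∫ t in a..x, p t) a b := by
  have hre : IntervalIntegrable (fun t => (p t).re) volume a b :=
    ⟨hp.1.re, hp.2.re⟩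
  have him : IntervalIntegrable (fun t => (p t).im) volume a b :=
    ⟨hp.1.im, hp.2.im⟩
  have hconst (c : ℂ) : AbsolutelyContinuousOnInterval (fun _ : ℝ => c) a b :=
    ((LipschitzWith.const c).lipschitzOnWith (s := Set.uIcc a b)).absolutelyContinuousOnInterval
  have key := ((hre.absolutelyContinuousOnInterval_intervalIntegral (c := a) (by simp)).smul
    (hconst 1)).add ((him.absolutelyContinuousOnInterval_intervalIntegral (c := a) (by simp)).smul
    (hconst Complex.I))
  rw [absolutelyContinuousOnInterval_iff] at key ⊢
  intro ε hε
  obtain ⟨δ, hδ, h⟩ := key ε hε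
  refine ⟨δ, hδ, fun E hE hl => ?_⟩
  refine lt_of_le_of_lt (le_of_eq (Finset.sum_congr rfl fun i hi => ?_)) (h E hE hl)
  have hval (x : ℝ) (hx : x ∈ Set.uIcc a b) : (∫ t in a..x, p t) =
      (∫ t in a..x, (p t).re) • (1 : ℂ) + (∫ t in a..x, (p t).im) • Complex.I := by
    have hsub : Set.uIcc a x ⊆ Set.uIcc a b := Set.uIcc_subset_uIcc_left hx
    have h1 : IntervalIntegrable (fun t => ((p t).re : ℂ)) volume a x :=
      ⟨(hre.mono_set hsub).1.ofReal, (hre.mono_set hsub).2.ofReal⟩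
    have h2 : IntervalIntegrable (fun t => ((p t).im : ℂ)) volume a x :=
      ⟨(him.mono_set hsub).1.ofReal, (him.mono_set hsub).2.ofReal⟩
    simp only [Complex.real_smul, mul_one]
    rw [← intervalIntegral.integral_ofReal, ← intervalIntegral.integral_ofReal,
      ← intervalIntegral.integral_mul_const, ← intervalIntegral.integral_add h1
        (h2.mul_const _)]
    exact intervalIntegral.integral_congr fun t _ => (Complex.re_add_im (p t)).symm
  have hm := hE.1 i hi
  rw [hval _ hm.1, hval _ hm.2]
  rfl

namespace IsPrimitiveOn

variable {a b : ℝ} {P p Q q : ℝ → ℂ}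

theorem continuousOn (hab : a ≤ b) (hP : IsPrimitiveOn a b P p) :
    ContinuousOn P (Set.Icc a b) := by
  refine ContinuousOn.congr (continuousOn_const.add ?_) hP.2
  have := intervalIntegral.continuousOn_primitive_interval' hP.1 Set.left_mem_uIcc
  rwa [Set.uIcc_of_le hab] at this

theorem mul (hab : a ≤ b) (hP : IsPrimitiveOn a b P p) (hQ : IsPrimitiveOn a b Q q) :
    IsPrimitiveOn a b (fun x => P x * Q x) (fun x => p x * Q x + P x * q x) := by
  have hPc := hP.continuousOn hab
  have hQc := hQ.continuousOn hab
  rw [← Set.uIcc_of_le hab] at hPc hQc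
  have hpQ : IntervalIntegrable (fun x => p x * Q x + P x * q x) volume a b :=
    (hP.1.mul_continuousOn hQc).add (hQ.1.continuousOn_mul hPc)
  refine ⟨hpQ, fun x hx => ?_⟩
  set P' : ℝ → ℂ := fun x => P a + ∫ t in a..x, p t
  set Q' : ℝ → ℂ := fun x => Q a + ∫ t in a..x, q t
  have hconst (c : ℂ) : AbsolutelyContinuousOnInterval (fun _ : ℝ => c) a b :=
    ((LipschitzWith.const c).lipschitzOnWith (s := Set.uIcc a b)).absolutelyContinuousOnInterval
  have hP' : AbsolutelyContinuousOnInterval P' a b :=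
    (hconst _).add hP.1.absolutelyContinuousOnInterval_integral_complex
  have hQ' : AbsolutelyContinuousOnInterval Q' a b :=
    (hconst _).add hQ.1.absolutelyContinuousOnInterval_integral_complex
  have hG := (hP'.smul hQ').sub hpQ.absolutelyContinuousOnInterval_integral_complex
  obtain ⟨C, hC⟩ := hG.const_of_ae_hasDerivAt_zero (by
    filter_upwards [hP.1.ae_hasDerivAt_integral, hQ.1.ae_hasDerivAt_integral,
      hpQ.ae_hasDerivAt_integral] with y h1 h2 h3 hy
    have hyI : y ∈ Set.Icc a b := by rwa [Set.uIcc_of_le hab] at hy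
    have h1' : HasDerivAt P' (p y) y := (h1 hy a Set.left_mem_uIcc).const_add _
    have h2' : HasDerivAt Q' (q y) y := (h2 hy a Set.left_mem_uIcc).const_add _
    have := (h1'.mul h2').sub (h3 hy a Set.left_mem_uIcc)
    convert! this using 1
    rw [hP.2 y hyI, hQ.2 y hyI]
    ring)
  have e1 := hC a Set.left_mem_uIcc
  have e2 := hC x (by rwa [Set.uIcc_of_le hab])
  rw [← e2] at e1
  simp only [Pi.sub_apply, Pi.mul_apply, smul_eq_mul, P', Q', intervalIntegral.integral_same,
    add_zero, sub_zero] at e1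
  rw [← hP.2 x hx, ← hQ.2 x hx] at e1
  linear_combination -e1

theorem of_hasDerivWithinAt (hab : a ≤ b)
    (h : ∀ x ∈ Set.Icc a b, HasDerivWithinAt P (p x) (Set.Icc a b) x)
    (hp : ContinuousOn p (Set.Icc a b)) : IsPrimitiveOn a b P p := by
  have hi : IntervalIntegrable p volume a b :=
    (by rwa [Set.uIcc_of_le hab] : ContinuousOn p (Set.uIcc a b)).intervalIntegrable
  refine ⟨hi, fun x hx => ?_⟩
  have hsub : Set.Icc a x ⊆ Set.Icc a b := Set.Icc_subset_Icc_right hx.2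
  rw [intervalIntegral.integral_eq_sub_of_hasDeriv_right_of_le hx.1
    (fun y hy => ((h y (hsub hy)).continuousWithinAt.mono hsub)) (f' := p) (fun y hy => ?_)
    (hi.mono_set (by rwa [Set.uIcc_of_le hab, Set.uIcc_of_le hx.1]))]
  · ring
  · exact ((h y (hsub (Set.Ioo_subset_Icc_self hy))).hasDerivAt
      (Icc_mem_nhds hy.1 (hy.2.trans_le hx.2))).hasDerivWithinAt

end IsPrimitiveOn

theorem hasDerivAt_max_zero_pow (n : ℕ) (y : ℝ) :
    HasDerivAt (fun y : ℝ => max 0 y ^ (n + 2)) ((n + 2) * max 0 y ^ (n + 1)) y := by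
  rcases lt_trichotomy y 0 with hy | rfl | hy
  · rw [max_eq_left hy.le, zero_pow (by omega), mul_zero]
    refine (hasDerivAt_const y (0 : ℝ)).congr_of_eventuallyEq ?_
    filter_upwards [Iio_mem_nhds hy] with x hx
    rw [max_eq_left (Set.mem_Iio.1 hx).le, zero_pow (by omega)]
  · rw [hasDerivAt_iff_isLittleO_nhds_zero]
    have h2 : (fun h : ℝ => h ^ (n + 2)) =o[nhds 0] fun h : ℝ => h := by
      simpa using Asymptotics.isLittleO_pow_pow (𝕜 := ℝ) (show 1 < n + 2 by omega)
    refine Asymptotics.IsBigO.trans_isLittleO ?_ h2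
    refine Asymptotics.IsBigO.of_bound 1 (Eventually.of_forall fun h => ?_)
    simp only [zero_add, max_self, zero_pow (show n + 2 ≠ 0 by omega),
      zero_pow (show n + 1 ≠ 0 by omega), mul_zero, smul_zero, sub_zero, norm_pow, one_mul]
    gcongr
    rw [Real.norm_eq_abs, Real.norm_eq_abs, abs_of_nonneg (le_max_left _ _)]
    exact max_le (abs_nonneg _) (le_abs_self _)
  · rw [max_eq_right hy.le]
    have := (hasDerivAt_pow (n + 2) y)
    simp only [Nat.cast_add, Nat.cast_ofNat,
      show n + 2 - 1 = n + 1 by omega] at this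
    refine this.congr_of_eventuallyEq ?_
    filter_upwards [Ioi_mem_nhds hy] with x hx
    rw [max_eq_right (Set.mem_Ioi.1 hx).le]

/-- A `C²` function supported within distance `ε` of the endpoint `e` of an interval lying on the
side `σ = ±1` of `e`, with slope `-σ` at `e` and second derivative a peak function at `e`. -/
def cutoff (e σ ε x : ℝ) : ℝ := max 0 (ε - σ * (x - e)) ^ 3 / (3 * ε ^ 2)

/-- The derivative of `cutoff`. -/
def dcutoff (e σ ε x : ℝ) : ℝ := -σ * (max 0 (ε - σ * (x - e)) ^ 2 / ε ^ 2)

/-- The second derivative of `cutoff`. -/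
def ddcutoff (e σ ε x : ℝ) : ℝ := 2 * max 0 (ε - σ * (x - e)) / ε ^ 2

/-- `e` is an endpoint of `[0,R]`, with the interval lying on the side `σ` of it. -/
def IsEndpoint (R e σ : ℝ) : Prop := (e = 0 ∧ σ = 1) ∨ (e = R ∧ σ = -1)

section cutoff

variable {R e σ ε : ℝ}

theorem IsEndpoint.sq (h : IsEndpoint R e σ) : σ * σ = 1 := by
  rcases h with h | h <;> simp [h]

theorem IsEndpoint.mem (h : IsEndpoint R e σ) (hR : 0 < R) : e ∈ Set.Icc 0 R := by
  rcases h with h | h <;> simp [h, hR.le]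

theorem IsEndpoint.mul_sub_eq_abs (h : IsEndpoint R e σ) {x : ℝ} (hx : x ∈ Set.Icc 0 R) :
    σ * (x - e) = |x - e| := by
  rcases h with ⟨rfl, rfl⟩ | ⟨rfl, rfl⟩
  · rw [abs_of_nonneg (by linarith [hx.1])]; ring
  · rw [abs_of_nonpos (by linarith [hx.2])]; ring

theorem hasDerivAt_cutoff (hε : 0 < ε) (x : ℝ) :
    HasDerivAt (cutoff e σ ε) (dcutoff e σ ε x) x := by
  have hl : HasDerivAt (fun x => ε - σ * (x - e)) (-(σ * 1)) x :=
    (((hasDerivAt_id x).sub_const e).const_mul σ).const_sub ε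
  have := ((hasDerivAt_max_zero_pow 1 (ε - σ * (x - e))).comp x hl).div_const (3 * ε ^ 2)
  convert! this using 1
  unfold dcutoff
  push_cast
  field_simp
  ring

theorem hasDerivAt_dcutoff (hσ : σ * σ = 1) (x : ℝ) :
    HasDerivAt (dcutoff e σ ε) (ddcutoff e σ ε x) x := by
  have hl : HasDerivAt (fun x => ε - σ * (x - e)) (-(σ * 1)) x :=
    (((hasDerivAt_id x).sub_const e).const_mul σ).const_sub ε
  have := (((hasDerivAt_max_zero_pow 0 (ε - σ * (x - e))).comp x hl).div_const
    (ε ^ 2)).const_mul (-σ)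
  convert! this using 1
  unfold ddcutoff
  push_cast
  linear_combination (-2 * max 0 (ε - σ * (x - e)) / ε ^ 2) * hσ

theorem continuous_ddcutoff : Continuous (ddcutoff e σ ε) := by
  unfold ddcutoff
  fun_prop

theorem dcutoff_eq : dcutoff e σ ε = fun x =>
    -σ * (ddcutoff e σ ε x * (ε - σ * (x - e)) / 2) := by
  funext x
  unfold dcutoff ddcutoff
  rcases le_total 0 (ε - σ * (x - e)) with h | h
  · rw [max_eq_right h]; ring
  · rw [max_eq_left h]; ring

theorem max_sub_mem (h : IsEndpoint R e σ) (hε : 0 < ε) {x : ℝ} (hx : x ∈ Set.Icc 0 R) :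
    max 0 (ε - σ * (x - e)) ∈ Set.Icc 0 ε := by
  rw [h.mul_sub_eq_abs hx]
  exact ⟨le_max_left _ _, max_le hε.le (by linarith [abs_nonneg (x - e)])⟩

theorem abs_cutoff_le (h : IsEndpoint R e σ) (hε : 0 < ε) {x : ℝ} (hx : x ∈ Set.Icc 0 R) :
    |cutoff e σ ε x| ≤ ε := by
  obtain ⟨h0, h1⟩ := max_sub_mem h hε hx
  unfold cutoff
  rw [abs_of_nonneg (by positivity), div_le_iff₀ (by positivity)]
  have := pow_le_pow_left₀ h0 h1 3
  nlinarith [pow_pos hε 3]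

theorem abs_dcutoff_le (h : IsEndpoint R e σ) (hε : 0 < ε) {x : ℝ} (hx : x ∈ Set.Icc 0 R) :
    |dcutoff e σ ε x| ≤ 1 := by
  obtain ⟨h0, h1⟩ := max_sub_mem h hε hx
  unfold dcutoff
  have hσ : |(-σ)| = 1 := by rcases h with h | h <;> simp [h]
  rw [abs_mul, hσ, one_mul, abs_of_nonneg (by positivity), div_le_one (by positivity)]
  exact pow_le_pow_left₀ h0 h1 2

theorem ddcutoff_nonneg (x : ℝ) : 0 ≤ ddcutoff e σ ε x := by
  unfold ddcutoff
  positivity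

theorem abs_ddcutoff_le (h : IsEndpoint R e σ) (hε : 0 < ε) {x : ℝ} (hx : x ∈ Set.Icc 0 R) :
    |ddcutoff e σ ε x| ≤ 2 / ε := by
  obtain ⟨h0, h1⟩ := max_sub_mem h hε hx
  rw [abs_of_nonneg (ddcutoff_nonneg x)]
  unfold ddcutoff
  rw [div_le_div_iff₀ (by positivity) hε]
  nlinarith

theorem integral_ddcutoff (h : IsEndpoint R e σ) (hR : 0 < R) (hε : 0 < ε) (hεR : ε < R) :
    ∫ x in Set.Icc 0 R, ddcutoff e σ ε x = 1 := by
  rw [integral_Icc_eq_integral_Ioc, ← intervalIntegral.integral_of_le hR.le,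
    intervalIntegral.integral_eq_sub_of_hasDerivAt (fun x _ => hasDerivAt_dcutoff h.sq x)
    (continuous_ddcutoff.intervalIntegrable _ _)]
  unfold dcutoff
  rcases h with ⟨rfl, rfl⟩ | ⟨rfl, rfl⟩
  · rw [max_eq_left (by linarith), max_eq_right (by linarith)]
    field_simp
    ring
  · rw [max_eq_right (by linarith), max_eq_left (by linarith)]
    field_simp
    ring

theorem tendsto_integral_ddcutoff_smul (h : IsEndpoint R e σ) (hR : 0 < R) {g : ℝ → ℂ}
    (hg : ContinuousOn g (Set.Icc 0 R)) :
    Tendsto (fun ε => ∫ x in Set.Icc 0 R, ddcutoff e σ ε x • g x) (nhdsWithin 0 (Set.Ioi 0))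
      (nhds (g e)) := by
  refine tendsto_setIntegral_peak_smul_of_integrableOn_of_tendsto (x₀ := e) measurableSet_Icc
    measurableSet_Icc subset_rfl self_mem_nhdsWithin (by simp)
    (Eventually.of_forall fun ε x _ => ddcutoff_nonneg x) ?_ ?_
    (Eventually.of_forall fun ε => continuous_ddcutoff.aestronglyMeasurable)
    hg.integrableOn_Icc (hg e (h.mem hR))
  · intro u hu heu
    obtain ⟨δ, hδ, hδu⟩ := Metric.isOpen_iff.1 hu e heu
    rw [Metric.tendstoUniformlyOn_iff]
    intro η hη
    filter_upwards [Ioo_mem_nhdsGT hδ] with ε hε x hx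
    have hd : δ ≤ |x - e| := by
      by_contra hlt
      exact hx.2 (hδu (by simpa [Real.dist_eq] using hlt))
    have : ddcutoff e σ ε x = 0 := by
      unfold ddcutoff
      rw [h.mul_sub_eq_abs hx.1, max_eq_left (by linarith [hε.2])]
      simp
    simpa [this] using hη
  · refine tendsto_const_nhds.congr' ?_
    filter_upwards [Ioo_mem_nhdsGT hR] with ε hε
    exact (integral_ddcutoff h hR hε.1 hε.2).symm

theorem tendsto_integral_dcutoff_smul (h : IsEndpoint R e σ) (hR : 0 < R) {g : ℝ → ℂ}
    (hg : ContinuousOn g (Set.Icc 0 R)) :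
    Tendsto (fun ε => ∫ x in Set.Icc 0 R, dcutoff e σ ε x • g x) (nhdsWithin 0 (Set.Ioi 0))
      (nhds 0) := by
  have hg' : ContinuousOn (fun x => (σ * (x - e)) • g x) (Set.Icc 0 R) :=
    (by fun_prop : Continuous fun x => σ * (x - e)).continuousOn.smul hg
  have h1 := tendsto_integral_ddcutoff_smul h hR hg
  have h2 := tendsto_integral_ddcutoff_smul h hR hg'
  have hid : Tendsto (fun ε : ℝ => ε) (nhdsWithin 0 (Set.Ioi 0)) (nhds 0) :=
    tendsto_id.mono_left nhdsWithin_le_nhds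
  have := ((hid.smul h1).sub h2).const_smul (-σ / 2)
  simp only [sub_self, mul_zero, zero_smul, smul_zero] at this
  refine this.congr fun ε => ?_
  have hi (k : ℝ → ℂ) (hk : ContinuousOn k (Set.Icc 0 R)) :
      IntegrableOn (fun x => ddcutoff e σ ε x • k x) (Set.Icc 0 R) :=
    (continuous_ddcutoff.continuousOn.smul hk).integrableOn_Icc
  have hig : IntegrableOn (fun x => ε • ddcutoff e σ ε x • g x) (Set.Icc 0 R) := (hi g hg).smul ε
  rw [← integral_smul, ← integral_sub hig (hi _ hg'), ← integral_smul, dcutoff_eq]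
  refine integral_congr_ae (Eventually.of_forall fun x => ?_)
  simp only [Complex.real_smul]
  push_cast
  ring

end cutoff

section SquareRoot

variable {E : Type*} [NormedAddCommGroup E] [InnerProductSpace ℂ E] [CompleteSpace E]
  {ι : Type*} {l : Filter ι}

/-- If `N` is symmetric and injective, `x` is bounded and `N x → N a`, then `x → a` weakly. -/
theorem tendsto_inner_of_tendsto_apply {N : E →L[ℂ] E}
    (hsymm : ∀ v w : E, ⟪N v, w⟫_ℂ = ⟪v, N w⟫_ℂ) (hinj : ∀ v, N v = 0 → v = 0)
    {x : ι → E} {a : E} {C : ℝ} (hC : ∀ᶠ i in l, ‖x i‖ ≤ C)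
    (hlim : Tendsto (fun i => N (x i)) l (nhds (N a))) (w : E) :
    Tendsto (fun i => ⟪x i, w⟫_ℂ) l (nhds ⟪a, w⟫_ℂ) := by
  have hdense : N.range.topologicalClosure = ⊤ := by
    rw [Submodule.topologicalClosure_eq_top_iff, Submodule.eq_bot_iff]
    intro v hv
    refine hinj v (ext_inner_left ℂ fun y => ?_)
    rw [inner_zero_right (𝕜 := ℂ) y, ← hsymm]
    exact (Submodule.mem_orthogonal _ _).1 hv _ ⟨y, rfl⟩
  set D := max C 0 + ‖a‖ + 1
  have hD : 0 < D := by positivity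
  rw [Metric.tendsto_nhds]
  intro η hη
  have hw : w ∈ closure (N.range : Set E) := by
    rw [← Submodule.topologicalClosure_coe, hdense]; trivial
  obtain ⟨_, ⟨v, rfl⟩, hv⟩ := Metric.mem_closure_iff.1 hw (η / 2 / D) (by positivity)
  have hlim' : Tendsto (fun i => ⟪N (x i) - N a, v⟫_ℂ) l (nhds 0) := by
    simpa only [sub_self, inner_zero_left] using (hlim.sub_const (N a)).inner (𝕜 := ℂ)
      (tendsto_const_nhds (x := v))
  filter_upwards [hC, Metric.tendsto_nhds.1 hlim' (η / 2) (by positivity)] with i hi hi'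
  rw [dist_zero_right] at hi'
  have hsplit : ⟪x i, w⟫_ℂ - ⟪a, w⟫_ℂ = ⟪x i - a, w - N v⟫_ℂ + ⟪N (x i) - N a, v⟫_ℂ := by
    rw [← map_sub, hsymm, ← inner_add_right, sub_add_cancel, inner_sub_left]
  have hxD : ‖x i - a‖ ≤ D := by
    have := norm_sub_le (x i) a
    have := le_max_left C 0
    simp only [D]
    linarith
  have hwv : ‖w - N v‖ < η / 2 / D := by simpa [dist_eq_norm] using hv
  rw [dist_eq_norm, hsplit]
  calc _ ≤ ‖x i - a‖ * ‖w - N v‖ + ‖⟪N (x i) - N a, v⟫_ℂ‖ :=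
        (norm_add_le _ _).trans (by gcongr; exact norm_inner_le_norm _ _)
    _ < D * (η / 2 / D) + η / 2 :=
        add_lt_add_of_le_of_lt (by gcongr) hi'
    _ = η := by field_simp; ring

/-- A net of vectors `h` along which `N² h → N a`, with `‖h‖ ‖N² h - N a‖` and `⟪h, N a⟫`
bounded, satisfies `N h → a` weakly. -/
theorem tendsto_inner_sqrt {N : E →L[ℂ] E}
    (hsymm : ∀ v w : E, ⟪N v, w⟫_ℂ = ⟪v, N w⟫_ℂ) (hinj : ∀ v, N v = 0 → v = 0)
    {h : ι → E} {a : E} {C : ℝ} {L : ℂ}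
    (hlim : Tendsto (fun i => N (N (h i))) l (nhds (N a)))
    (hC : ∀ᶠ i in l, ‖h i‖ * ‖N (N (h i)) - N a‖ ≤ C)
    (hL : Tendsto (fun i => ⟪h i, N a⟫_ℂ) l (nhds L)) (w : E) :
    Tendsto (fun i => ⟪h i, N w⟫_ℂ) l (nhds ⟪a, w⟫_ℂ) := by
  simp_rw [← hsymm]
  have hbound : ∀ᶠ i in l, ‖N (h i)‖ ≤ ‖L‖ + 1 + C + 1 := by
    filter_upwards [hC, hL.norm.eventually_lt_const (lt_add_one ‖L‖)] with i h1 h2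
    have hsq : ‖N (h i)‖ ^ 2 ≤ ‖L‖ + 1 + C := by
      have hself : ‖N (h i)‖ ^ 2 = ‖⟪N (h i), N (h i)⟫_ℂ‖ := by
        rw [inner_self_eq_norm_sq_to_K]
        simp
      rw [hself]
      have : ⟪N (h i), N (h i)⟫_ℂ = ⟪h i, N a⟫_ℂ + ⟪h i, N (N (h i)) - N a⟫_ℂ := by
        rw [hsymm, ← inner_add_right, add_sub_cancel]
      rw [this]
      exact (norm_add_le _ _).trans
        (add_le_add h2.le ((norm_inner_le_norm _ _).trans h1))
    nlinarith [sq_nonneg (‖N (h i)‖ - 1), sq_nonneg (‖N (h i)‖)]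
  exact tendsto_inner_of_tendsto_apply hsymm hinj hbound hlim w

end SquareRoot

section SchSp

variable {R : ℝ}

theorem ContinuousOn.memLp_two_Ioo {g : ℝ → ℂ} (hg : ContinuousOn g (Set.Icc 0 R)) :
    MemLp g 2 (volume.restrict (Set.Ioo (0 : ℝ) R)) := by
  obtain ⟨C, hC⟩ := isCompact_Icc.exists_bound_of_continuousOn hg
  exact MemLp.of_bound
    ((hg.mono Set.Ioo_subset_Icc_self).aestronglyMeasurable measurableSet_Ioo) C
    (ae_restrict_of_forall_mem measurableSet_Ioo fun x hx => hC x (Set.Ioo_subset_Icc_self hx))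

theorem SchSp.exists_norm_le (R : ℝ) : ∃ K : ℝ, 0 ≤ K ∧ ∀ (f : SchSp R) (g : ℝ → ℂ) (C : ℝ),
    0 ≤ C → (∀ᵐ x ∂(volume.restrict (Set.Ioo (0 : ℝ) R)), f x = g x) →
    (∀ x ∈ Set.Icc 0 R, ‖g x‖ ≤ C) → ‖f‖ ≤ K * C := by
  refine ⟨_, by positivity, fun f g C hC hfg hg => Lp.norm_le_of_ae_bound hC ?_⟩
  filter_upwards [hfg, ae_restrict_mem measurableSet_Ioo] with x hx hxI
  rw [hx]
  exact hg x (Set.Ioo_subset_Icc_self hxI)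

theorem SchSp.inner_eq_integral {f g : SchSp R} {F G : ℝ → ℂ}
    (hf : ∀ᵐ x ∂(volume.restrict (Set.Ioo (0 : ℝ) R)), f x = F x)
    (hg : ∀ᵐ x ∂(volume.restrict (Set.Ioo (0 : ℝ) R)), g x = G x) :
    ⟪f, g⟫_ℂ = ∫ x in Set.Icc 0 R, (starRingEnd ℂ) (F x) * G x := by
  rw [L2.inner_def, integral_Icc_eq_integral_Ioo]
  refine integral_congr_ae ?_
  filter_upwards [hf, hg] with x h1 h2
  rw [h1, h2, RCLike.inner_apply, mul_comm]

end SchSp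

section SolODE

variable {R : ℝ} {V : ℝ → ℝ} {z : ℂ} {u du v dv : ℝ → ℂ}

theorem SolODE.isPrimitiveOn (hR : 0 < R) (hV : IntegrableOn V (Set.Ioo 0 R) volume)
    (h : SolODE R (fun x => (V x : ℂ)) z u du) :
    IsPrimitiveOn 0 R u du ∧ IsPrimitiveOn 0 R du (fun x => (V x - z) * u x) := by
  have hu : ContinuousOn u (Set.Icc 0 R) := fun x hx => (h.1 x hx).continuousWithinAt
  have hVi : IntervalIntegrable (fun x => (V x : ℂ)) volume 0 R :=
    (intervalIntegrable_iff_integrableOn_Ioo_of_le hR.le).2 hV.ofReal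
  have hdu : IsPrimitiveOn 0 R du (fun x => (V x - z) * u x) :=
    ⟨(hVi.sub intervalIntegrable_const).mul_continuousOn (by rwa [Set.uIcc_of_le hR.le]), h.2⟩
  exact ⟨.of_hasDerivWithinAt hR.le h.1 (hdu.continuousOn hR.le), hdu⟩

theorem SolODE.wronskian_eq (hR : 0 < R) (hV : IntegrableOn V (Set.Ioo 0 R) volume)
    (hu : SolODE R (fun x => (V x : ℂ)) z u du) (hv : SolODE R (fun x => (V x : ℂ)) z v dv) :
    u R * dv R - du R * v R = u 0 * dv 0 - du 0 * v 0 := by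
  obtain ⟨hu1, hu2⟩ := hu.isPrimitiveOn hR hV
  obtain ⟨hv1, hv2⟩ := hv.isPrimitiveOn hR hV
  have h1 := (hu1.mul hR.le hv2).2 R (Set.right_mem_Icc.2 hR.le)
  have h2 := (hu2.mul hR.le hv1).2 R (Set.right_mem_Icc.2 hR.le)
  have : ∫ t in (0 : ℝ)..R, (du t * dv t + u t * ((V t - z) * v t)) =
      ∫ t in (0 : ℝ)..R, ((V t - z) * u t * v t + du t * dv t) :=
    intervalIntegral.integral_congr fun t _ => by ring
  linear_combination h1 - h2 + this

theorem SolODE.mul_cutoff (hR : 0 < R) (hV : IntegrableOn V (Set.Ioo 0 R) volume)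
    (h : SolODE R (fun x => (V x : ℂ)) z u du) {e σ ε : ℝ} (hσ : σ * σ = 1) (hε : 0 < ε) (k : ℂ) :
    (∀ x ∈ Set.Icc 0 R, HasDerivWithinAt (fun x => u x * (1 + k * cutoff e σ ε x))
      (du x * (1 + k * cutoff e σ ε x) + u x * (k * dcutoff e σ ε x)) (Set.Icc 0 R) x) ∧
    ∀ x ∈ Set.Icc 0 R, du x * (1 + k * cutoff e σ ε x) + u x * (k * dcutoff e σ ε x) =
      du 0 * (1 + k * cutoff e σ ε 0) + u 0 * (k * dcutoff e σ ε 0) +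
        ∫ t in (0 : ℝ)..x, (V t * (u t * (1 + k * cutoff e σ ε t)) -
          0 * (u t * (1 + k * cutoff e σ ε t)) -
          (-k * (2 * du t * dcutoff e σ ε t + u t * ddcutoff e σ ε t) +
            z * (u t * (1 + k * cutoff e σ ε t)))) := by
  obtain ⟨hu1, hu2⟩ := h.isPrimitiveOn hR hV
  have hA (x : ℝ) : HasDerivAt (fun x => 1 + k * (cutoff e σ ε x : ℂ)) (k * dcutoff e σ ε x) x :=
    ((hasDerivAt_cutoff hε x).ofReal_comp.const_mul k).const_add 1
  have hB (x : ℝ) : HasDerivAt (fun x => k * (dcutoff e σ ε x : ℂ)) (k * ddcutoff e σ ε x) x :=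
    (hasDerivAt_dcutoff hσ x).ofReal_comp.const_mul k
  have hA' : IsPrimitiveOn 0 R (fun x => 1 + k * (cutoff e σ ε x : ℂ))
      (fun x => k * dcutoff e σ ε x) :=
    .of_hasDerivWithinAt hR.le (fun x _ => (hA x).hasDerivWithinAt)
      fun x _ => (hB x).continuousAt.continuousWithinAt
  have hB' : IsPrimitiveOn 0 R (fun x => k * (dcutoff e σ ε x : ℂ))
      (fun x => k * ddcutoff e σ ε x) :=
    .of_hasDerivWithinAt hR.le (fun x _ => (hB x).hasDerivWithinAt)
      (continuous_const.mul (Complex.continuous_ofReal.comp continuous_ddcutoff)).continuousOn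
  refine ⟨fun x hx => (h.1 x hx).mul (hA x).hasDerivWithinAt, fun x hx => ?_⟩
  have h1 := hu2.mul hR.le hA'
  have h2 := hu1.mul hR.le hB'
  have hsub : Set.uIcc 0 x ⊆ Set.uIcc 0 R := by
    rw [Set.uIcc_of_le hR.le, Set.uIcc_of_le hx.1]
    exact Set.Icc_subset_Icc_right hx.2
  have e1 := h1.2 x hx
  have e2 := h2.2 x hx
  simp only at e1 e2
  rw [e1, e2, add_add_add_comm, ← intervalIntegral.integral_add (h1.1.mono_set hsub)
    (h2.1.mono_set hsub)]
  congr 1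
  exact intervalIntegral.integral_congr fun t _ => by ring

end SolODE

section Resolvent

variable {E : Type*} [NormedAddCommGroup E] [InnerProductSpace ℂ E]
  {A : E →ₗ.[ℂ] E} {z : ℂ} {T : E →L[ℂ] E}

theorem IsResolvent.injective (hT : IsResolvent A z T) {x : E} (hx : T x = 0) : x = 0 := by
  obtain ⟨hm, h⟩ := hT.1 x
  have : (⟨T x, hm⟩ : A.domain) = 0 := Subtype.ext hx
  rw [this, A.map_zero, hx, smul_zero, sub_zero] at h
  exact h.symm

theorem IsResolvent.apply_eq (hT : IsResolvent A z T) {f h : E}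
    (hf : (f, h + z • f) ∈ A.graph) : T h = f := by
  obtain ⟨y, hy, hAy⟩ := (LinearPMap.mem_graph_iff _).1 hf
  simp only at hy hAy
  have := hT.2 y
  rwa [hAy, hy, add_sub_cancel_right] at this

end Resolvent

section Core

variable {R : ℝ} {V : ℝ → ℝ} {t0 tR : ℂ} {A : SchSp R →ₗ.[ℂ] SchSp R} {z : ℂ}
  {T N : SchSp R →L[ℂ] SchSp R} {u du : ℝ → ℂ} {e σ : ℝ} {m : ℂ}

theorem IsSchrodingerOp.resolvent_apply_cutoff (hR : 0 < R)
    (hV : IntegrableOn V (Set.Ioo 0 R) volume)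
    (hA : IsSchrodingerOp R (fun x => (V x : ℂ)) t0 tR A) (hT : IsResolvent A z T)
    (hu : SolODE R (fun x => (V x : ℂ)) z u du) (he : IsEndpoint R e σ) (hue : u e = 1)
    (hbc : ∀ g dg : ℝ → ℂ, dg e = m * g e → g (R - e) = u (R - e) → dg (R - e) = du (R - e) →
      bdryC R t0 tR g dg = 0)
    {ε : ℝ} (hε : 0 < ε) (hεR : ε < R) (hne : 1 - σ * (du e - m) * ε / 3 ≠ 0) {k : ℂ}
    (hk : k = σ * (du e - m) / (1 - σ * (du e - m) * ε / 3)) {f h : SchSp R}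
    (hf : ∀ᵐ x ∂(volume.restrict (Set.Ioo (0 : ℝ) R)), f x = u x * (1 + k * cutoff e σ ε x))
    (hh : ∀ᵐ x ∂(volume.restrict (Set.Ioo (0 : ℝ) R)),
      h x = -k * (2 * du x * dcutoff e σ ε x + u x * ddcutoff e σ ε x)) :
    T h = f := by
  refine hT.apply_eq ((hA _ _).2 ?_)
  obtain ⟨h1, h2⟩ := hu.mul_cutoff hR hV he.sq hε k
  refine ⟨_, fun x => du x * (1 + k * cutoff e σ ε x) + u x * (k * dcutoff e σ ε x),
    ⟨hf, h1, _, ?_, h2⟩, hbc _ _ ?_ ?_ ?_⟩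
  · filter_upwards [hf, hh, Lp.coeFn_add h (z • f), Lp.coeFn_smul z f] with x e1 e2 e3 e4
    rw [e3, Pi.add_apply, e4, Pi.smul_apply, e1, e2, smul_eq_mul]
  · have hc : cutoff e σ ε e = ε / 3 := by
      unfold cutoff
      rw [sub_self, mul_zero, sub_zero, max_eq_right hε.le]
      field_simp
    have hd : dcutoff e σ ε e = -σ := by
      unfold dcutoff
      rw [sub_self, mul_zero, sub_zero, max_eq_right hε.le]
      field_simp
    have hσ : (σ : ℂ) * σ = 1 := by exact_mod_cast he.sq
    have hk' : k * (1 - σ * (du e - m) * ε / 3) = σ * (du e - m) := by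
      rw [hk, div_mul_cancel₀ _ hne]
    rw [hc, hd, hue]
    push_cast
    linear_combination (-σ) * hk' - (k * (du e - m) * ε / 3 + du e - m) * hσ
  all_goals
    have hfar : max 0 (ε - σ * (R - e - e)) = 0 := by
      apply max_eq_left
      rcases he with ⟨rfl, rfl⟩ | ⟨rfl, rfl⟩ <;> linarith
    simp [cutoff, dcutoff, hfar]

/-- Let `a = (A - z)^{1/2} u` for a solution `u` with `u e = 1` which satisfies the boundary
condition of `A` at the endpoint opposite to `e`; the condition at `e` reads `g' e = m * g e`.
Then `⟪a, (A - z)^{1/2} w⟫` is a boundary term at `e`. -/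
theorem IsSchrodingerOp.inner_sqrt_eq (hR : 0 < R)
    (hV : IntegrableOn V (Set.Ioo 0 R) volume)
    (hA : IsSchrodingerOp R (fun x => (V x : ℂ)) t0 tR A) (hT : IsResolvent A z T)
    (hsymm : ∀ v w : SchSp R, ⟪N v, w⟫_ℂ = ⟪v, N w⟫_ℂ) (hNN : ∀ v, N (N v) = T v)
    (hu : SolODE R (fun x => (V x : ℂ)) z u du) (he : IsEndpoint R e σ) (hue : u e = 1)
    (hbc : ∀ g dg : ℝ → ℂ, dg e = m * g e → g (R - e) = u (R - e) → dg (R - e) = du (R - e) →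
      bdryC R t0 tR g dg = 0)
    {a b : SchSp R} {w : ℝ → ℂ} (hw : ContinuousOn w (Set.Icc 0 R))
    (ha : ∀ᵐ x ∂(volume.restrict (Set.Ioo (0 : ℝ) R)), (N a) x = u x)
    (hb : ∀ᵐ x ∂(volume.restrict (Set.Ioo (0 : ℝ) R)), (N b) x = w x) :
    ⟪a, b⟫_ℂ = -(starRingEnd ℂ) (σ * (du e - m)) * w e := by
  have huc : ContinuousOn u (Set.Icc 0 R) := (hu.isPrimitiveOn hR hV).1.continuousOn hR.le
  have hduc : ContinuousOn du (Set.Icc 0 R) := (hu.isPrimitiveOn hR hV).2.continuousOn hR.le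
  have hcut (ε : ℝ) : Continuous fun x => (cutoff e σ ε x : ℂ) := by unfold cutoff; fun_prop
  have hdcut (ε : ℝ) : Continuous fun x => (dcutoff e σ ε x : ℂ) := by unfold dcutoff; fun_prop
  have hddcut (ε : ℝ) : Continuous fun x => (ddcutoff e σ ε x : ℂ) := by
    unfold ddcutoff; fun_prop
  set c : ℂ := σ * (du e - m) with hc
  let k : ℝ → ℂ := fun ε => c / (1 - c * ε / 3)
  have hid : Tendsto (fun ε : ℝ => ε) (nhdsWithin 0 (Set.Ioi 0)) (nhds 0) :=
    tendsto_id.mono_left nhdsWithin_le_nhds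
  have hden : Tendsto (fun ε : ℝ => 1 - c * ε / 3) (nhdsWithin 0 (Set.Ioi 0)) (nhds 1) := by
    have : Continuous fun ε : ℝ => 1 - c * ε / 3 := by fun_prop
    simpa using (this.tendsto 0).mono_left (nhdsWithin_le_nhds (s := Set.Ioi 0))
  have hk : Tendsto k (nhdsWithin 0 (Set.Ioi 0)) (nhds c) := by
    have := (tendsto_const_nhds (x := c)).div hden one_ne_zero
    rwa [div_one] at this
  have hFc (ε : ℝ) : ContinuousOn (fun x => u x * (1 + k ε * cutoff e σ ε x)) (Set.Icc 0 R) :=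
    huc.mul (continuous_const.add (continuous_const.mul (hcut ε))).continuousOn
  have hHc (ε : ℝ) : ContinuousOn
      (fun x => -k ε * (2 * du x * dcutoff e σ ε x + u x * ddcutoff e σ ε x)) (Set.Icc 0 R) :=
    continuousOn_const.mul (((continuousOn_const.mul hduc).mul (hdcut ε).continuousOn).add
      (huc.mul (hddcut ε).continuousOn))
  let F : ℝ → SchSp R := fun ε => (hFc ε).memLp_two_Ioo.toLp
  let H : ℝ → SchSp R := fun ε => (hHc ε).memLp_two_Ioo.toLp
  have hF (ε : ℝ) := (hFc ε).memLp_two_Ioo.coeFn_toLp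
  have hH (ε : ℝ) := (hHc ε).memLp_two_Ioo.coeFn_toLp
  have hTH : ∀ᶠ ε in nhdsWithin (0 : ℝ) (Set.Ioi 0), N (N (H ε)) = F ε := by
    filter_upwards [Ioo_mem_nhdsGT hR, hden.eventually_ne one_ne_zero] with ε hε hne
    rw [hNN]
    exact hA.resolvent_apply_cutoff hR hV hT hu he hue hbc hε.1 hε.2 hne rfl (hF ε) (hH ε)
  obtain ⟨K, hK, hKle⟩ := SchSp.exists_norm_le R
  obtain ⟨Mu, hMu⟩ := isCompact_Icc.exists_bound_of_continuousOn huc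
  obtain ⟨Md, hMd⟩ := isCompact_Icc.exists_bound_of_continuousOn hduc
  have hMu0 : 0 ≤ Mu := (norm_nonneg _).trans (hMu e (he.mem hR))
  have hMd0 : 0 ≤ Md := (norm_nonneg _).trans (hMd e (he.mem hR))
  have hkle : ∀ᶠ ε in nhdsWithin (0 : ℝ) (Set.Ioi 0), ‖k ε‖ ≤ ‖c‖ + 1 := by
    filter_upwards [hk.norm.eventually_lt_const (lt_add_one ‖c‖)] with ε h using h.le
  have hFle : ∀ᶠ ε in nhdsWithin (0 : ℝ) (Set.Ioi 0),
      ‖F ε - N a‖ ≤ K * (Mu * ((‖c‖ + 1) * ε)) := by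
    filter_upwards [hkle, self_mem_nhdsWithin] with ε hkε hε
    have hε : 0 < ε := hε
    refine hKle _ (fun x => u x * (k ε * cutoff e σ ε x)) _ (by positivity) ?_ fun x hx => ?_
    · filter_upwards [hF ε, ha, Lp.coeFn_sub (F ε) (N a)] with x h1 h2 h3
      rw [h3, Pi.sub_apply, h1, h2]
      ring
    · rw [norm_mul, norm_mul, Complex.norm_real, Real.norm_eq_abs]
      gcongr
      · exact hMu x hx
      · exact abs_cutoff_le he hε hx
  have hHle : ∀ᶠ ε in nhdsWithin (0 : ℝ) (Set.Ioi 0),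
      ‖H ε‖ ≤ K * ((‖c‖ + 1) * (2 * Md * 1 + Mu * (2 / ε))) := by
    filter_upwards [hkle, self_mem_nhdsWithin] with ε hkε hε
    have hε : 0 < ε := hε
    refine hKle _ _ _ (by positivity) (hH ε) fun x hx => ?_
    rw [norm_mul, norm_neg]
    gcongr
    refine (norm_add_le _ _).trans ?_
    rw [norm_mul, norm_mul, norm_mul, Complex.norm_real, Complex.norm_real, Real.norm_eq_abs,
      Real.norm_eq_abs, Complex.norm_ofNat]
    gcongr
    · exact hMd x hx
    · exact abs_dcutoff_le he hε hx
    · exact hMu x hx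
    · exact abs_ddcutoff_le he hε hx
  have hinner {v : SchSp R} {g : ℝ → ℂ} (hg : ContinuousOn g (Set.Icc 0 R))
      (hv : ∀ᵐ x ∂(volume.restrict (Set.Ioo (0 : ℝ) R)), v x = g x) :
      Tendsto (fun ε => ⟪H ε, v⟫_ℂ) (nhdsWithin 0 (Set.Ioi 0))
        (nhds (-(starRingEnd ℂ) c * g e)) := by
    have hg1 : ContinuousOn (fun x => (starRingEnd ℂ) (du x) * g x) (Set.Icc 0 R) :=
      (Complex.continuous_conj.comp_continuousOn hduc).mul hg
    have hg2 : ContinuousOn (fun x => (starRingEnd ℂ) (u x) * g x) (Set.Icc 0 R) :=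
      (Complex.continuous_conj.comp_continuousOn huc).mul hg
    have hlim := ((Complex.continuous_conj.tendsto c).comp hk).neg.mul
      (((tendsto_integral_dcutoff_smul he hR hg1).const_mul 2).add
        (tendsto_integral_ddcutoff_smul he hR hg2))
    rw [hue, map_one, one_mul, mul_zero, zero_add] at hlim
    refine hlim.congr fun ε => ?_
    have i1 : IntegrableOn (fun x => 2 * dcutoff e σ ε x • ((starRingEnd ℂ) (du x) * g x))
        (Set.Icc 0 R) := by
      simp only [Complex.real_smul]
      exact (continuousOn_const.mul ((hdcut ε).continuousOn.mul hg1)).integrableOn_Icc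
    have i2 : IntegrableOn (fun x => ddcutoff e σ ε x • ((starRingEnd ℂ) (u x) * g x))
        (Set.Icc 0 R) := by
      simp only [Complex.real_smul]
      exact ((hddcut ε).continuousOn.mul hg2).integrableOn_Icc
    rw [SchSp.inner_eq_integral (hH ε) hv, ← integral_const_mul, ← integral_add i1 i2,
      ← integral_const_mul]
    refine integral_congr_ae (Eventually.of_forall fun x => ?_)
    simp only [Complex.real_smul, map_mul, map_add, map_neg, Complex.conj_ofReal, map_ofNat,
      Function.comp_apply]
    ring
  have hFlim : Tendsto (fun ε => N (N (H ε))) (nhdsWithin 0 (Set.Ioi 0)) (nhds (N a)) := by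
    rw [tendsto_iff_norm_sub_tendsto_zero]
    have hz : Tendsto (fun ε : ℝ => K * (Mu * ((‖c‖ + 1) * ε))) (nhdsWithin 0 (Set.Ioi 0))
        (nhds 0) := by
      simpa using ((hid.const_mul (‖c‖ + 1)).const_mul Mu).const_mul K
    refine squeeze_zero' (Eventually.of_forall fun _ => norm_nonneg _) ?_ hz
    filter_upwards [hTH, hFle] with ε h1 h2
    rwa [h1]
  refine tendsto_nhds_unique (tendsto_inner_sqrt hsymm
    (C := K * ((‖c‖ + 1) * (2 * Md + 2 * Mu)) * (K * (Mu * (‖c‖ + 1)))) (fun v hv => ?_)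
    hFlim ?_ (hinner huc ha) b) (hinner hw hb)
  · exact hT.injective (by rw [← hNN, hv, map_zero])
  · filter_upwards [hTH, hFle, hHle, Ioo_mem_nhdsGT one_pos] with ε h1 h2 h3 hε
    have hε0 := hε.1
    rw [h1]
    calc _ ≤ K * ((‖c‖ + 1) * (2 * Md * 1 + Mu * (2 / ε))) * (K * (Mu * ((‖c‖ + 1) * ε))) := by
          gcongr
      _ = K * ((‖c‖ + 1) * (2 * Md * ε + 2 * Mu)) * (K * (Mu * (‖c‖ + 1))) := by
          field_simp
      _ ≤ K * ((‖c‖ + 1) * (2 * Md * 1 + 2 * Mu)) * (K * (Mu * (‖c‖ + 1))) := by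
          gcongr
          exact hε.2.le
      _ = _ := by ring

end Core
/-- the basic quadratic-form identities
`((H'-z)^{1/2}ǔ_±, (H'-z)^{1/2}ǔ_±)` for the normalized solutions `ǔ_±`; here `a, b ∈ L²`
with `(H'-z)^{-1/2} a = ǔ₊`, `(H'-z)^{-1/2} b = ǔ₋`, i.e. `a = (H'-z)^{1/2}ǔ₊`,
`b = (H'-z)^{1/2}ǔ₋`. -/
theorem statement13
    (Rr : ℝ) (hR : 0 < Rr) (V : ℝ → ℝ)
    (hV : MeasureTheory.IntegrableOn V (Set.Ioo 0 Rr) MeasureTheory.volume)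
    (t0' tR' : ℝ) (ht0' : t0' ∈ Set.Ioo 0 Real.pi) (htR' : tR' ∈ Set.Ioo 0 Real.pi)
    (Hop' : SchSp Rr →ₗ.[ℂ] SchSp Rr)
    (hHop' : IsSchrodingerOp Rr (fun x => (V x : ℂ)) (t0' : ℂ) (tR' : ℂ) Hop')
    (hsa' : IsSelfAdjoint Hop')
    (NH' : ℂ → (SchSp Rr →L[ℂ] SchSp Rr))
    (hNH' : IsSqrtResFam Rr Hop' (einf1 Rr Hop') NH')
    (z : ℝ) (hz : z < einf1 Rr Hop')
    (up dup um dum : ℝ → ℂ)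
    (hup : SolODE Rr (fun x => (V x : ℂ)) (z : ℂ) up dup)
    (hum : SolODE Rr (fun x => (V x : ℂ)) (z : ℂ) um dum)
    (hup0 : up 0 = 1)
    (hupR : (Real.cos tR' : ℂ) * up Rr - (Real.sin tR' : ℂ) * dup Rr = 0)
    (humR : um Rr = 1)
    (hum0 : (Real.cos t0' : ℂ) * um 0 + (Real.sin t0' : ℂ) * dum 0 = 0)
    (a b : SchSp Rr)
    (ha : ∀ᵐ x ∂(MeasureTheory.volume.restrict (Set.Ioo (0 : ℝ) Rr)),
      (NH' (z : ℂ) a) x = up x)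
    (hb : ∀ᵐ x ∂(MeasureTheory.volume.restrict (Set.Ioo (0 : ℝ) Rr)),
      (NH' (z : ℂ) b) x = um x) :
    ⟪a, a⟫_ℂ = -(dup 0 + ((Real.cos t0' / Real.sin t0' : ℝ) : ℂ)) ∧
    ⟪a, b⟫_ℂ = -(um 0 * (dup 0 + ((Real.cos t0' / Real.sin t0' : ℝ) : ℂ))) ∧
    ⟪a, b⟫_ℂ = up Rr * (dum Rr - ((Real.cos tR' / Real.sin tR' : ℝ) : ℂ)) ∧
    ⟪a, b⟫_ℂ = ⟪b, a⟫_ℂ ∧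
    ⟪b, b⟫_ℂ = dum Rr - ((Real.cos tR' / Real.sin tR' : ℝ) : ℂ) := by
  have hs0 : ((Real.sin t0' : ℝ) : ℂ) ≠ 0 :=
    Complex.ofReal_ne_zero.2 (Real.sin_pos_of_mem_Ioo ht0').ne'
  have hsR : ((Real.sin tR' : ℝ) : ℂ) ≠ 0 :=
    Complex.ofReal_ne_zero.2 (Real.sin_pos_of_mem_Ioo htR').ne'
  have hupc := (hup.isPrimitiveOn hR hV).1.continuousOn hR.le
  have humc := (hum.isPrimitiveOn hR hV).1.continuousOn hR.le
  obtain ⟨hsymm, -⟩ := hNH'.2.1 z hz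
  have hNN (v) : NH' z (NH' z v) = res Hop' z v := by
    rw [← hNH'.1 z (Or.inr (by simpa using hz))]
    rfl
  have hT : IsResolvent Hop' z (res Hop' z) := by
    by_cases hex : ∃ T, IsResolvent Hop' (z : ℂ) T
    · rw [res, dif_pos hex]
      exact hex.choose_spec
    · have hNa : NH' z a = 0 := by
        rw [← inner_self_eq_zero (𝕜 := ℂ), hsymm, hNN, res, dif_neg hex]
        exact inner_zero_right _
      have hae : up =ᵐ[volume.restrict (Set.Icc 0 Rr)] fun _ => (0 : ℂ) := by
        rw [← restrict_Ioo_eq_restrict_Icc]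
        filter_upwards [ha, Lp.coeFn_zero ℂ 2 (volume.restrict (Set.Ioo (0 : ℝ) Rr))]
          with x h1 h2
        rw [← h1, hNa, h2, Pi.zero_apply]
      have := Measure.eqOn_Icc_of_ae_eq volume hR.ne hae hupc continuousOn_const
        (Set.left_mem_Icc.2 hR.le)
      simp [hup0] at this
  have hcut0 : dum 0 = -((Real.cos t0' / Real.sin t0' : ℝ) : ℂ) * um 0 := by
    push_cast at hum0 hs0 ⊢
    field_simp
    linear_combination hum0
  have hcutR : dup Rr = ((Real.cos tR' / Real.sin tR' : ℝ) : ℂ) * up Rr := by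
    push_cast at hupR hsR ⊢
    field_simp
    linear_combination -hupR
  have hleft {w : ℝ → ℂ} {v : SchSp Rr} (hw : ContinuousOn w (Set.Icc 0 Rr))
      (hv : ∀ᵐ x ∂(volume.restrict (Set.Ioo (0 : ℝ) Rr)), (NH' z v) x = w x) :=
    hHop'.inner_sqrt_eq (m := -((Real.cos t0' / Real.sin t0' : ℝ) : ℂ)) hR hV hT hsymm hNN hup
      (.inl ⟨rfl, rfl⟩) hup0 (fun g dg h1 h2 h3 => by
        rw [sub_zero] at h2 h3
        rw [bdryC, h1, h2, h3, ← Complex.ofReal_cos, ← Complex.ofReal_cos, ← Complex.ofReal_sin,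
          ← Complex.ofReal_sin, hupR, Complex.ofReal_div]
        ext i
        fin_cases i
        · simp only [Fin.zero_eta, Matrix.cons_val_zero, Pi.zero_apply]
          field_simp
          ring
        · rfl) hw ha hv
  have hright {w : ℝ → ℂ} {v : SchSp Rr} (hw : ContinuousOn w (Set.Icc 0 Rr))
      (hv : ∀ᵐ x ∂(volume.restrict (Set.Ioo (0 : ℝ) Rr)), (NH' z v) x = w x) :=
    hHop'.inner_sqrt_eq (m := ((Real.cos tR' / Real.sin tR' : ℝ) : ℂ)) hR hV hT hsymm hNN hum
      (.inr ⟨rfl, rfl⟩) humR (fun g dg h1 h2 h3 => by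
        rw [sub_self] at h2 h3
        rw [bdryC, h1, h2, h3, ← Complex.ofReal_cos, ← Complex.ofReal_cos, ← Complex.ofReal_sin,
          ← Complex.ofReal_sin, hum0, Complex.ofReal_div]
        ext i
        fin_cases i
        · rfl
        · simp only [Fin.mk_one, Matrix.cons_val_one, Matrix.cons_val_zero, Pi.zero_apply]
          field_simp
          ring) hw hb hv
  have haa := hleft hupc ha
  have hab := hleft humc hb
  have hbb := hright humc hb
  have hba := hright hupc ha
  have hwr := hum.wronskian_eq hR hV hup
  rw [hup0, humR, hcutR, hcut0] at hwr
  have hreal_a := inner_conj_symm (𝕜 := ℂ) a a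
  have hreal_b := inner_conj_symm (𝕜 := ℂ) b b
  rw [haa, hup0] at hreal_a
  rw [hbb, humR] at hreal_b
  simp only [map_neg, Complex.conj_conj, Complex.ofReal_one, one_mul, Complex.ofReal_neg,
    mul_one, neg_mul, neg_neg, sub_neg_eq_add, neg_inj] at hreal_a hreal_b
  simp only [Complex.ofReal_one, one_mul, map_neg, Complex.ofReal_neg, neg_mul, neg_neg,
    sub_neg_eq_add, ← hreal_a, ← hreal_b] at haa hab hba hbb
  rw [hup0] at haa
  rw [humR] at hbb
  refine ⟨?_, ?_, ?_, ?_, ?_⟩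
  · linear_combination haa
  · linear_combination hab
  · linear_combination hab + hwr
  · linear_combination hab - hba + hwr
  · linear_combination hbb


end
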